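/- Let α ∈ (0, 1) ∪ (1, ∞) and let ρ_ABC be a positive semidefinite complex matrix indexed by (Fin d_A × Fin d_B × Fin d_C) with Tr[ρ_ABC] = 1. Then the chain rule H̃_α(A|BC)_ρ ≥ H̃_α(AC|B)_ρ − log d'_C holds, where d'_C is the rank of the marginal ρ_C obtained by taking the partial trace of ρ_ABC over the A and B systems, H̃_α(A|BC)_ρ is the conditional Rényi entropy of ρ_ABC with first system A and conditioning system B × C, and H̃_α(AC|B)_ρ is the conditional Rényi entropy of the same matrix reindexed so that the first system is A × C and the conditioning system is B. -/

import Mathlib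

open Matrix
open scoped Kronecker Classical ComplexOrder

/-- Real power of a matrix via functional calculus on the eigenvalues of a Hermitian
matrix, with the convention that eigenvalue `0` is mapped to `0` (powers are taken on
the support). Non-Hermitian matrices are mapped to `0`. -/
noncomputable def matPow {n : Type*} [Fintype n] [DecidableEq n]
    (A : Matrix n n ℂ) (t : ℝ) : Matrix n n ℂ :=
  if hA : A.IsHermitian then
    (hA.eigenvectorUnitary : Matrix n n ℂ) *
      Matrix.diagonal (fun i =>
        ((if hA.eigenvalues i = 0 then (0 : ℝ) else hA.eigenvalues i ^ t : ℝ) : ℂ)) *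
      (star (hA.eigenvectorUnitary : Matrix n n ℂ))
  else 0

/-- `dominates σ ρ` (written `σ ≫ ρ` in the paper): the kernel of `σ` is contained in
the kernel of `ρ`. -/
def dominates {n : Type*} [Fintype n] (σ ρ : Matrix n n ℂ) : Prop :=
  ∀ v : n → ℂ, σ.mulVec v = 0 → ρ.mulVec v = 0

/-- The sandwiched Rényi divergence of order `α`, with values in `ℝ ∪ {+∞}` (as a
subset of `EReal`), logarithms base 2. It is `+∞` unless `ρ` is not orthogonal to `σ`
(i.e. `Tr[ρσ] ≠ 0`) and (`σ ≫ ρ` or `α < 1`). -/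
noncomputable def Dtilde {n : Type*} [Fintype n] [DecidableEq n]
    (α : ℝ) (ρ σ : Matrix n n ℂ) : EReal :=
  if (ρ * σ).trace ≠ 0 ∧ (dominates σ ρ ∨ α < 1) then
    (((α - 1)⁻¹ * Real.logb 2
        ((matPow (matPow σ ((1 - α) / (2 * α)) * ρ * matPow σ ((1 - α) / (2 * α))) α).trace.re
          / ρ.trace.re) : ℝ) : EReal)
  else ⊤

/-- The conditional Rényi entropy of order `α` of a bipartite state `ρ` on `A × B`:
the supremum over nonzero positive semidefinite `σ` on `B` with trace at most `1` of
`-D̃_α(ρ ‖ 1_A ⊗ σ)`. -/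
noncomputable def condH {A B : Type*} [Fintype A] [DecidableEq A] [Fintype B] [DecidableEq B]
    (α : ℝ) (ρ : Matrix (A × B) (A × B) ℂ) : ℝ :=
  sSup {x : ℝ | ∃ σ : Matrix B B ℂ, σ.PosSemidef ∧ σ ≠ 0 ∧ σ.trace.re ≤ 1 ∧
    (x : EReal) = - Dtilde α ρ ((1 : Matrix A A ℂ) ⊗ₖ σ)}

/-- Reindexing equivalence `(A × B × C) ≃ ((A × C) × B)`. -/
def eACB (dA dB dC : ℕ) : (Fin dA × Fin dB × Fin dC) ≃ ((Fin dA × Fin dC) × Fin dB) where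
  toFun x := ((x.1, x.2.2), x.2.1)
  invFun y := (y.1.1, y.2, y.1.2)
  left_inv _ := rfl
  right_inv _ := rfl


/-- The scalar function underlying `matPow`: `x ↦ x ^ t` with `0 ↦ 0`. -/
noncomputable def supportPow (t x : ℝ) : ℝ := if x = 0 then 0 else x ^ t

lemma supportPow_nonneg {x : ℝ} (hx : 0 ≤ x) (t : ℝ) : 0 ≤ supportPow t x := by
  unfold supportPow
  split_ifs
  · rfl
  · exact Real.rpow_nonneg hx t

lemma supportPow_mul {x y : ℝ} (hx : 0 ≤ x) (hy : 0 ≤ y) (t : ℝ) :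
    supportPow t (x * y) = supportPow t x * supportPow t y := by
  unfold supportPow
  by_cases h : x = 0
  · simp [h]
  by_cases h' : y = 0
  · simp [h']
  simp [h, h', Real.mul_rpow hx hy]

lemma supportPow_add {x : ℝ} (hx : 0 ≤ x) (s t : ℝ) :
    supportPow (s + t) x = supportPow s x * supportPow t x := by
  unfold supportPow
  split_ifs with h
  · simp
  · exact Real.rpow_add (lt_of_le_of_ne hx (Ne.symm h)) s t

lemma supportPow_one (x : ℝ) : supportPow 1 x = x := by
  unfold supportPow
  split_ifs with h
  · exact h.symm
  · exact Real.rpow_one x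

lemma supportPow_supportPow_zero (t x : ℝ) :
    supportPow t (supportPow 0 x) = supportPow 0 x := by
  unfold supportPow
  split_ifs <;> simp_all

lemma trace_reindex_self {n m : Type*} [Fintype n] [Fintype m] (e : n ≃ m)
    (A : Matrix n n ℂ) : (reindex e e A).trace = A.trace := by
  simp only [trace, reindex_apply, diag_apply, submatrix_apply]
  exact e.symm.sum_comp fun i => A i i

section

variable {n m : Type*} [Fintype n] [DecidableEq n] [Fintype m] [DecidableEq m]

/-- The matrix `U diag(d) U*`. -/
noncomputable def conjDiagonal (U : Matrix n n ℂ) (d : n → ℝ) : Matrix n n ℂ :=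
  U * diagonal (fun i => (d i : ℂ)) * Uᴴ

lemma conjDiagonal_isHermitian (U : Matrix n n ℂ) (d : n → ℝ) :
    (conjDiagonal U d).IsHermitian := by
  simp only [IsHermitian, conjDiagonal, conjTranspose_mul, conjTranspose_conjTranspose,
    diagonal_conjTranspose, ← mul_assoc]
  congr 3
  ext i
  simp

lemma conjDiagonal_posSemidef (U : Matrix n n ℂ) {d : n → ℝ} (hd : ∀ i, 0 ≤ d i) :
    (conjDiagonal U d).PosSemidef :=
  PosSemidef.mul_mul_conjTranspose_same
    (posSemidef_diagonal_iff.2 fun i => by exact_mod_cast hd i) U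

lemma Matrix.IsHermitian.eq_conjDiagonal {A : Matrix n n ℂ} (hA : A.IsHermitian) :
    A = conjDiagonal (hA.eigenvectorUnitary : Matrix n n ℂ) hA.eigenvalues := by
  conv_lhs => rw [hA.spectral_theorem]
  rfl

lemma Matrix.IsHermitian.matPow_eq_conjDiagonal {A : Matrix n n ℂ} (hA : A.IsHermitian) (t : ℝ) :
    matPow A t = conjDiagonal (hA.eigenvectorUnitary : Matrix n n ℂ)
      (fun i => supportPow t (hA.eigenvalues i)) := by
  rw [matPow, dif_pos hA]
  rfl

lemma conjDiagonal_mul {U : Matrix n n ℂ} (hU : Uᴴ * U = 1) (d e : n → ℝ) :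
    conjDiagonal U d * conjDiagonal U e = conjDiagonal U (fun i => d i * e i) := by
  have : conjDiagonal U d * conjDiagonal U e =
      U * diagonal (fun i => (d i : ℂ)) * (Uᴴ * U) * diagonal (fun i => (e i : ℂ)) * Uᴴ := by
    simp only [conjDiagonal, mul_assoc]
  rw [this, hU, mul_one, mul_assoc U, diagonal_mul_diagonal]
  simp [conjDiagonal]

lemma trace_conjDiagonal {U : Matrix n n ℂ} (hU : Uᴴ * U = 1) (d : n → ℝ) :
    (conjDiagonal U d).trace = ((∑ i, d i : ℝ) : ℂ) := by
  rw [conjDiagonal, trace_mul_comm, ← mul_assoc, hU, one_mul, trace_diagonal]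
  simp

lemma conjDiagonal_one {U : Matrix n n ℂ} (hU : U * Uᴴ = 1) :
    conjDiagonal U (fun _ => 1) = 1 := by
  simp [conjDiagonal, hU]

lemma conjDiagonal_sub (U : Matrix n n ℂ) (d e : n → ℝ) :
    conjDiagonal U d - conjDiagonal U e = conjDiagonal U (fun i => d i - e i) := by
  simp only [conjDiagonal, ← sub_mul, ← mul_sub, diagonal_sub]
  simp

lemma smul_conjDiagonal (c : ℝ) (U : Matrix n n ℂ) (d : n → ℝ) :
    (c : ℂ) • conjDiagonal U d = conjDiagonal U (fun i => c * d i) := by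
  have : (diagonal fun i => ((c * d i : ℝ) : ℂ)) = (c : ℂ) • diagonal fun i => (d i : ℂ) := by
    ext i j
    by_cases h : i = j <;> simp [diagonal, h]
  simp only [conjDiagonal, this, Matrix.mul_smul, Matrix.smul_mul]

lemma conjDiagonal_kronecker (U : Matrix n n ℂ) (V : Matrix m m ℂ) (d : n → ℝ) (e : m → ℝ) :
    conjDiagonal U d ⊗ₖ conjDiagonal V e
      = conjDiagonal (U ⊗ₖ V) (fun i => d i.1 * e i.2) := by
  simp only [conjDiagonal, conjTranspose_kronecker, mul_kronecker_mul,
    diagonal_kronecker_diagonal]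
  simp

lemma reindex_conjDiagonal (e : n ≃ m) (U : Matrix n n ℂ) (d : n → ℝ) :
    reindex e e (conjDiagonal U d) = conjDiagonal (reindex e e U) (fun i => d (e.symm i)) := by
  simp only [conjDiagonal, reindex_apply, conjTranspose_submatrix,
    ← submatrix_mul_equiv _ _ _ e.symm]
  congr 2
  simp [submatrix_diagonal_equiv, Function.comp_def]

lemma matPow_conjDiagonal {U : Matrix n n ℂ} (hU : Uᴴ * U = 1) (d : n → ℝ) (t : ℝ) :
    matPow (conjDiagonal U d) t = conjDiagonal U (fun i => supportPow t (d i)) := by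
  have hA := conjDiagonal_isHermitian U d
  rw [hA.matPow_eq_conjDiagonal]
  set V : Matrix n n ℂ := (hA.eigenvectorUnitary : Matrix n n ℂ) with hV
  have hV1 : Vᴴ * V = 1 := mem_unitaryGroup_iff'.1 hA.eigenvectorUnitary.2
  have hV2 : V * Vᴴ = 1 := mem_unitaryGroup_iff.1 hA.eigenvectorUnitary.2
  have hU2 : U * Uᴴ = 1 := mul_eq_one_comm.1 hU
  have key : diagonal (fun i => (hA.eigenvalues i : ℂ)) * (Vᴴ * U)
      = (Vᴴ * U) * diagonal (fun i => (d i : ℂ)) := by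
    have h := hA.eq_conjDiagonal
    rw [← hV] at h
    calc diagonal (fun i => (hA.eigenvalues i : ℂ)) * (Vᴴ * U)
        = (Vᴴ * V) * diagonal (fun i => (hA.eigenvalues i : ℂ)) * (Vᴴ * U) := by
          rw [hV1, one_mul]
      _ = Vᴴ * conjDiagonal V hA.eigenvalues * U := by simp only [conjDiagonal, mul_assoc]
      _ = Vᴴ * conjDiagonal U d * U := by rw [← h]
      _ = (Vᴴ * U) * diagonal (fun i => (d i : ℂ)) * (Uᴴ * U) := by
          simp only [conjDiagonal, mul_assoc]
      _ = _ := by rw [hU, mul_one]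
  have key2 : diagonal (fun i => (supportPow t (hA.eigenvalues i) : ℂ)) * (Vᴴ * U)
      = (Vᴴ * U) * diagonal (fun i => (supportPow t (d i) : ℂ)) := by
    ext i j
    have h := congrFun (congrFun key i) j
    rw [diagonal_mul, mul_diagonal] at h ⊢
    by_cases hz : (Vᴴ * U) i j = 0
    · simp [hz]
    · rw [mul_comm] at h
      have h' := mul_left_cancel₀ hz h
      rw [Complex.ofReal_inj.1 h', mul_comm]
  calc conjDiagonal V (fun i => supportPow t (hA.eigenvalues i))
      = V * (diagonal (fun i => (supportPow t (hA.eigenvalues i) : ℂ)) * (Vᴴ * U)) * Uᴴ := by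
        simp only [conjDiagonal, mul_assoc, hU2, mul_one]
    _ = (V * Vᴴ) * U * diagonal (fun i => (supportPow t (d i) : ℂ)) * Uᴴ := by
        rw [key2]; simp only [mul_assoc]
    _ = _ := by rw [hV2, one_mul]; rfl

lemma Matrix.PosSemidef.exists_eq_conjDiagonal {A : Matrix n n ℂ} (hA : A.PosSemidef) :
    ∃ (U : Matrix n n ℂ) (d : n → ℝ), Uᴴ * U = 1 ∧ U * Uᴴ = 1 ∧ (∀ i, 0 ≤ d i) ∧
      A = conjDiagonal U d :=
  ⟨_, _, mem_unitaryGroup_iff'.1 hA.isHermitian.eigenvectorUnitary.2,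
    mem_unitaryGroup_iff.1 hA.isHermitian.eigenvectorUnitary.2, hA.eigenvalues_nonneg,
    hA.isHermitian.eq_conjDiagonal⟩

lemma Matrix.PosSemidef.matPow {A : Matrix n n ℂ} (hA : A.PosSemidef) (t : ℝ) :
    (matPow A t).PosSemidef := by
  rw [hA.isHermitian.matPow_eq_conjDiagonal]
  exact conjDiagonal_posSemidef _ fun i => supportPow_nonneg (hA.eigenvalues_nonneg i) t

lemma matPow_mul_matPow {A : Matrix n n ℂ} (hA : A.PosSemidef) (s t : ℝ) :
    matPow A s * matPow A t = matPow A (s + t) := by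
  obtain ⟨U, d, hU, -, hd, rfl⟩ := hA.exists_eq_conjDiagonal
  simp only [matPow_conjDiagonal hU, conjDiagonal_mul hU, supportPow_add (hd _)]

lemma matPow_one_right {A : Matrix n n ℂ} (hA : A.PosSemidef) : matPow A 1 = A := by
  obtain ⟨U, d, hU, -, -, rfl⟩ := hA.exists_eq_conjDiagonal
  simp only [matPow_conjDiagonal hU, supportPow_one]

lemma matPow_one_left (t : ℝ) : matPow (1 : Matrix n n ℂ) t = 1 := by
  have h : (1 : Matrix n n ℂ) = conjDiagonal 1 (fun _ => 1) := (conjDiagonal_one (by simp)).symm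
  conv_lhs => rw [h]
  rw [matPow_conjDiagonal (by simp)]
  simpa [supportPow] using h.symm

lemma matPow_matPow_zero {A : Matrix n n ℂ} (hA : A.PosSemidef) (t : ℝ) :
    matPow (matPow A 0) t = matPow A 0 := by
  obtain ⟨U, d, hU, -, -, rfl⟩ := hA.exists_eq_conjDiagonal
  simp only [matPow_conjDiagonal hU, supportPow_supportPow_zero]

lemma matPow_smul {A : Matrix n n ℂ} (hA : A.PosSemidef) {c : ℝ} (hc : 0 < c) (t : ℝ) :
    matPow ((c : ℂ) • A) t = ((c ^ t : ℝ) : ℂ) • matPow A t := by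
  obtain ⟨U, d, hU, -, hd, rfl⟩ := hA.exists_eq_conjDiagonal
  simp only [smul_conjDiagonal, matPow_conjDiagonal hU, supportPow_mul hc.le (hd _)]
  simp only [supportPow, if_neg hc.ne']

lemma matPow_kronecker {A : Matrix n n ℂ} {B : Matrix m m ℂ} (hA : A.PosSemidef)
    (hB : B.PosSemidef) (t : ℝ) : matPow (A ⊗ₖ B) t = matPow A t ⊗ₖ matPow B t := by
  obtain ⟨U, d, hU, -, hd, rfl⟩ := hA.exists_eq_conjDiagonal
  obtain ⟨V, e, hV, -, he, rfl⟩ := hB.exists_eq_conjDiagonal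
  rw [conjDiagonal_kronecker, matPow_conjDiagonal, matPow_conjDiagonal hU,
    matPow_conjDiagonal hV, conjDiagonal_kronecker]
  · simp only [supportPow_mul (hd _) (he _)]
  · rw [conjTranspose_kronecker, ← mul_kronecker_mul, hU, hV, one_kronecker_one]

lemma matPow_reindex (e : n ≃ m) {A : Matrix n n ℂ} (hA : A.PosSemidef) (t : ℝ) :
    matPow (reindex e e A) t = reindex e e (matPow A t) := by
  obtain ⟨U, d, hU, -, -, rfl⟩ := hA.exists_eq_conjDiagonal
  rw [reindex_conjDiagonal, matPow_conjDiagonal, matPow_conjDiagonal hU, reindex_conjDiagonal]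
  rw [reindex_apply, conjTranspose_submatrix, submatrix_mul_equiv, hU, submatrix_one_equiv]

lemma mul_matPow_zero {A : Matrix n n ℂ} (hA : A.PosSemidef) : A * matPow A 0 = A := by
  conv_lhs => enter [1]; rw [← matPow_one_right hA]
  rw [matPow_mul_matPow hA, add_zero, matPow_one_right hA]

lemma one_sub_matPow_zero_posSemidef {A : Matrix n n ℂ} (hA : A.PosSemidef) :
    (1 - matPow A 0).PosSemidef := by
  obtain ⟨U, d, hU, hU', hd, rfl⟩ := hA.exists_eq_conjDiagonal
  rw [matPow_conjDiagonal hU, ← conjDiagonal_one hU', conjDiagonal_sub]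
  refine conjDiagonal_posSemidef U fun i => ?_
  unfold supportPow
  split_ifs <;> simp

lemma one_sub_matPow_posSemidef {A : Matrix n n ℂ} (hA : A.PosSemidef)
    (hA1 : (1 - A).PosSemidef) {t : ℝ} (ht : 0 ≤ t) : (1 - matPow A t).PosSemidef := by
  obtain ⟨U, d, hU, hU', hd, rfl⟩ := hA.exists_eq_conjDiagonal
  have h : Uᴴ * (1 - conjDiagonal U d) * U = diagonal (fun i => ((1 - d i : ℝ) : ℂ)) := by
    rw [← conjDiagonal_one hU', conjDiagonal_sub]
    calc _ = (Uᴴ * U) * diagonal (fun i => ((1 - d i : ℝ) : ℂ)) * (Uᴴ * U) := by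
          simp only [conjDiagonal, mul_assoc]
      _ = _ := by rw [hU, one_mul, mul_one]
  have h2 := hA1.conjTranspose_mul_mul_same U
  rw [h, posSemidef_diagonal_iff] at h2
  rw [matPow_conjDiagonal hU, ← conjDiagonal_one hU', conjDiagonal_sub]
  refine conjDiagonal_posSemidef U fun i => ?_
  have h3 : 0 ≤ 1 - d i := by exact_mod_cast h2 i
  unfold supportPow
  split_ifs
  · simp
  · exact sub_nonneg.2 (Real.rpow_le_one (hd i) (by linarith) ht)

lemma trace_matPow_zero {A : Matrix n n ℂ} (hA : A.PosSemidef) :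
    (matPow A 0).trace = (A.rank : ℂ) := by
  rw [hA.isHermitian.rank_eq_card_non_zero_eigs, hA.isHermitian.matPow_eq_conjDiagonal,
    trace_conjDiagonal (mem_unitaryGroup_iff'.1 hA.isHermitian.eigenvectorUnitary.2),
    Fintype.card_subtype, Finset.card_filter]
  push_cast
  refine Finset.sum_congr rfl fun i _ => ?_
  unfold supportPow
  split_ifs <;> simp_all

lemma trace_matPow_re {A : Matrix n n ℂ} (hA : A.IsHermitian) (t : ℝ) :
    (matPow A t).trace.re = ∑ i, supportPow t (hA.eigenvalues i) := by
  rw [hA.matPow_eq_conjDiagonal,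
    trace_conjDiagonal (mem_unitaryGroup_iff'.1 hA.eigenvectorUnitary.2), Complex.ofReal_re]

lemma trace_re_eq_sum_eigenvalues {A : Matrix n n ℂ} (hA : A.IsHermitian) :
    A.trace.re = ∑ i, hA.eigenvalues i := by
  rw [hA.trace_eq_sum_eigenvalues, ← Complex.ofReal_re (∑ i, hA.eigenvalues i)]
  push_cast
  rfl

lemma matPow_half_mul_self {A : Matrix n n ℂ} (hA : A.PosSemidef) :
    matPow A (1 / 2) * matPow A (1 / 2) = A := by
  rw [matPow_mul_matPow hA, add_halves, matPow_one_right hA]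

lemma trace_mul_re_nonneg {A B : Matrix n n ℂ} (hA : A.PosSemidef) (hB : B.PosSemidef) :
    0 ≤ (A * B).trace.re := by
  have h := matPow_half_mul_self hB
  have h2 : (A * B).trace = (matPow B (1 / 2) * A * (matPow B (1 / 2))ᴴ).trace := by
    rw [(hB.matPow (1 / 2)).isHermitian.eq, trace_mul_comm, trace_mul_cycle]
    rw [h]
  rw [h2]
  exact (Complex.le_def.1 (hA.mul_mul_conjTranspose_same _).trace_nonneg).1

lemma mul_eq_zero_of_trace {A B : Matrix n n ℂ} (hA : A.PosSemidef) (hB : B.PosSemidef)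
    (h0 : (A * B).trace = 0) : A * B = 0 := by
  have h1 := matPow_half_mul_self hA
  have h2 := matPow_half_mul_self hB
  have eA := (hA.matPow (1 / 2)).isHermitian.eq
  have eB := (hB.matPow (1 / 2)).isHermitian.eq
  set a := matPow A (1 / 2)
  set b := matPow B (1 / 2)
  have h3 : ((a * b)ᴴ * (a * b)).trace = 0 := by
    rw [conjTranspose_mul, eA, eB, ← h0, ← h1, ← h2]
    rw [show b * a * (a * b) = b * (a * a) * b by simp only [mul_assoc], trace_mul_comm,
      trace_mul_comm, trace_mul_cycle, trace_mul_comm]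
  rw [(posSemidef_conjTranspose_mul_self _).trace_eq_zero_iff,
    conjTranspose_mul_self_eq_zero] at h3
  rw [← h1, ← h2, show a * a * (b * b) = a * (a * b) * b by simp only [mul_assoc], h3]
  simp

lemma trace_matPow_le_card {X : Matrix n n ℂ} (hX : X.PosSemidef) (htr : X.trace.re ≤ 1)
    {α : ℝ} (hα : 0 < α) : (matPow X α).trace.re ≤ Fintype.card n := by
  rw [trace_re_eq_sum_eigenvalues hX.isHermitian] at htr
  rw [trace_matPow_re hX.isHermitian]
  have h : ∀ i, supportPow α (hX.isHermitian.eigenvalues i) ≤ 1 := by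
    intro i
    have h1 : hX.isHermitian.eigenvalues i ≤ 1 :=
      (Finset.single_le_sum (fun j _ => hX.eigenvalues_nonneg j) (Finset.mem_univ i)).trans htr
    unfold supportPow
    split_ifs
    · exact zero_le_one
    · exact Real.rpow_le_one (hX.eigenvalues_nonneg i) h1 hα.le
  calc _ ≤ ∑ _i : n, (1 : ℝ) := Finset.sum_le_sum fun i _ => h i
    _ = _ := by simp

lemma rpow_le_trace_matPow [Nonempty n] {X : Matrix n n ℂ} (hX : X.PosSemidef)
    (htr : 1 ≤ X.trace.re) {α : ℝ} (hα : 0 < α) :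
    ((Fintype.card n : ℝ)⁻¹) ^ α ≤ (matPow X α).trace.re := by
  rw [trace_re_eq_sum_eigenvalues hX.isHermitian] at htr
  rw [trace_matPow_re hX.isHermitian]
  have hc : (0 : ℝ) < Fintype.card n := by exact_mod_cast Fintype.card_pos
  obtain ⟨i, -, hi⟩ : ∃ i ∈ Finset.univ,
      (Fintype.card n : ℝ)⁻¹ ≤ hX.isHermitian.eigenvalues i := by
    refine Finset.exists_le_of_sum_le Finset.univ_nonempty ?_
    simpa [hc.ne'] using htr
  refine le_trans ?_ (Finset.single_le_sum
    (fun j _ => supportPow_nonneg (hX.eigenvalues_nonneg j) α) (Finset.mem_univ i))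
  have hpos := lt_of_lt_of_le (inv_pos.2 hc) hi
  rw [supportPow, if_neg hpos.ne']
  exact Real.rpow_le_rpow (inv_pos.2 hc).le hi hα.le

lemma trace_conj_matPow {ρ S : Matrix n n ℂ} (hS : S.PosSemidef) (t : ℝ) :
    (matPow S t * ρ * matPow S t).trace = (ρ * matPow S (t + t)).trace := by
  rw [trace_mul_comm, ← mul_assoc, matPow_mul_matPow hS, trace_mul_comm]

lemma Matrix.PosSemidef.conj_matPow {ρ S : Matrix n n ℂ} (hρ : ρ.PosSemidef)
    (hS : S.PosSemidef) (t : ℝ) : (_root_.matPow S t * ρ * _root_.matPow S t).PosSemidef := by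
  have h := hρ.conjTranspose_mul_mul_same (_root_.matPow S t)
  rwa [(hS.matPow t).isHermitian.eq] at h

lemma trace_mul_matPow_re_le {ρ S : Matrix n n ℂ} (hρ : ρ.PosSemidef) (hS : S.PosSemidef)
    (hS1 : (1 - S).PosSemidef) {t : ℝ} (ht : 0 ≤ t) :
    (ρ * matPow S t).trace.re ≤ ρ.trace.re := by
  have h := trace_mul_re_nonneg hρ (one_sub_matPow_posSemidef hS hS1 ht)
  rw [mul_sub, mul_one, trace_sub, Complex.sub_re] at h
  linarith

lemma mul_matPow_zero_of_dominates {ρ S : Matrix n n ℂ} (hS : S.PosSemidef)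
    (h : dominates S ρ) : ρ * matPow S 0 = ρ := by
  have h0 : S * (1 - matPow S 0) = 0 := by rw [mul_sub, mul_one, mul_matPow_zero hS, sub_self]
  have h1 : ρ * (1 - matPow S 0) = 0 := by
    ext i j
    have h2 := h ((1 - matPow S 0).col j) (by
      ext k; exact congrFun (congrFun h0 k) j)
    exact congrFun h2 i
  rw [mul_sub, mul_one, sub_eq_zero] at h1
  exact h1.symm

lemma one_le_trace_conj_matPow {ρ S : Matrix n n ℂ} (hρ : ρ.PosSemidef) (htr : ρ.trace = 1)
    (hS : S.PosSemidef) (hS1 : (1 - S).PosSemidef) (hdom : dominates S ρ) {t : ℝ}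
    (ht : t ≤ 0) : 1 ≤ (matPow S t * ρ * matPow S t).trace.re := by
  have h := trace_mul_matPow_re_le (hρ.conj_matPow hS t) hS hS1
    (t := -t + -t) (by linarith)
  refine le_trans (le_of_eq ?_) h
  rw [mul_assoc, trace_mul_comm, ← mul_assoc, matPow_mul_matPow hS,
    matPow_mul_matPow hS, trace_mul_comm]
  rw [show t + (-t + -t) + t = 0 by ring, mul_matPow_zero_of_dominates hS hdom, htr,
    Complex.one_re]

lemma exists_neg_Dtilde_le [Nonempty n] {α : ℝ} (hα : α ∈ Set.Ioo (0 : ℝ) 1 ∪ Set.Ioi 1)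
    {ρ : Matrix n n ℂ} (hρ : ρ.PosSemidef) (htr : ρ.trace = 1) :
    ∃ M : ℝ, ∀ S : Matrix n n ℂ, S.PosSemidef → (1 - S).PosSemidef →
      ∀ x : ℝ, (x : EReal) = - Dtilde α ρ S → x ≤ M := by
  have hα0 : 0 < α := by
    rcases hα with h | h
    · exact h.1
    · exact zero_lt_one.trans h
  have hc1 : (1 : ℝ) ≤ Fintype.card n := by exact_mod_cast Fintype.card_pos
  refine ⟨|α - 1|⁻¹ * max 1 α * Real.logb 2 (Fintype.card n), fun S hS hS1 x hx => ?_⟩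
  have hlog : 0 ≤ Real.logb 2 (Fintype.card n) := Real.logb_nonneg one_lt_two hc1
  unfold Dtilde at hx
  split_ifs at hx with hcond
  swap
  · simp at hx
  rw [htr, Complex.one_re, div_one] at hx
  set t := (1 - α) / (2 * α) with ht
  have hX := hρ.conj_matPow hS t
  set X := matPow S t * ρ * matPow S t with hXdef
  have hx' : x = -((α - 1)⁻¹ * Real.logb 2 (matPow X α).trace.re) := by exact_mod_cast hx
  have hQ0 : 0 ≤ (matPow X α).trace.re :=
    (Complex.le_def.1 (hX.matPow α).trace_nonneg).1
  rcases hα with h | h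
  · have ht0 : 0 ≤ t := div_nonneg (by linarith [h.2]) (by linarith)
    have h1 : X.trace.re ≤ 1 := by
      rw [hXdef, trace_conj_matPow hS]
      exact (trace_mul_matPow_re_le hρ hS hS1 (by linarith)).trans (by simp [htr])
    have h2 : Real.logb 2 (matPow X α).trace.re ≤ Real.logb 2 (Fintype.card n) := by
      rcases hQ0.eq_or_lt with h0 | h0
      · rwa [← h0, Real.logb_zero]
      · exact Real.logb_le_logb_of_le one_lt_two h0 (trace_matPow_le_card hX h1 hα0)
    rw [hx', abs_of_neg (by linarith [h.2]), max_eq_left h.2.le, mul_one, inv_neg, neg_mul]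
    rw [neg_le_neg_iff]
    exact mul_le_mul_of_nonpos_left h2 (inv_nonpos.2 (by linarith [h.2]))
  · have h' : 1 < α := h
    have ht0 : t ≤ 0 := div_nonpos_of_nonpos_of_nonneg (by linarith) (by linarith)
    have h1 : 1 ≤ X.trace.re :=
      one_le_trace_conj_matPow hρ htr hS hS1 (hcond.2.resolve_right h'.not_gt) ht0
    have h2 : -(α * Real.logb 2 (Fintype.card n)) ≤ Real.logb 2 (matPow X α).trace.re := by
      refine le_trans (le_of_eq ?_) (Real.logb_le_logb_of_le one_lt_two
        (by positivity) (rpow_le_trace_matPow hX h1 hα0))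
      rw [Real.logb_rpow_eq_mul_logb_of_pos (by positivity), Real.logb_inv]
      ring
    have h3 : 0 ≤ (α - 1)⁻¹ := inv_nonneg.2 (by linarith)
    rw [hx', abs_of_pos (by linarith), max_eq_right h'.le]
    nlinarith [mul_le_mul_of_nonneg_left h2 h3]

lemma one_sub_posSemidef_of_trace_le {σ : Matrix n n ℂ} (hσ : σ.PosSemidef)
    (htr : σ.trace.re ≤ 1) : (1 - σ).PosSemidef := by
  obtain ⟨U, d, hU, hU', hd, rfl⟩ := hσ.exists_eq_conjDiagonal
  rw [trace_conjDiagonal hU, Complex.ofReal_re] at htr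
  rw [← conjDiagonal_one hU', conjDiagonal_sub]
  exact conjDiagonal_posSemidef U fun i => sub_nonneg.2
    ((Finset.single_le_sum (fun j _ => hd j) (Finset.mem_univ i)).trans htr)

lemma bddAbove_neg_Dtilde [Nonempty n] [Nonempty m] {α : ℝ}
    (hα : α ∈ Set.Ioo (0 : ℝ) 1 ∪ Set.Ioi 1)
    {ρ : Matrix (n × m) (n × m) ℂ} (hρ : ρ.PosSemidef) (htr : ρ.trace = 1) :
    BddAbove {x : ℝ | ∃ σ : Matrix m m ℂ, σ.PosSemidef ∧ σ ≠ 0 ∧ σ.trace.re ≤ 1 ∧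
      (x : EReal) = - Dtilde α ρ ((1 : Matrix n n ℂ) ⊗ₖ σ)} := by
  obtain ⟨M, hM⟩ := exists_neg_Dtilde_le hα hρ htr
  refine ⟨M, ?_⟩
  rintro x ⟨σ, hσ, -, hσ1, hx⟩
  refine hM _ (PosSemidef.one.kronecker hσ) ?_ x hx
  have h : (1 : Matrix (n × m) (n × m) ℂ) - (1 : Matrix n n ℂ) ⊗ₖ σ
      = (1 : Matrix n n ℂ) ⊗ₖ (1 - σ) := by
    rw [sub_eq_iff_eq_add, ← kronecker_add, sub_add_cancel, one_kronecker_one]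
  rw [h]
  exact PosSemidef.one.kronecker (one_sub_posSemidef_of_trace_le hσ hσ1)

lemma nonempty_neg_Dtilde [Nonempty m] (α : ℝ)
    {ρ : Matrix (n × m) (n × m) ℂ} (htr : ρ.trace = 1) :
    {x : ℝ | ∃ σ : Matrix m m ℂ, σ.PosSemidef ∧ σ ≠ 0 ∧ σ.trace.re ≤ 1 ∧
      (x : EReal) = - Dtilde α ρ ((1 : Matrix n n ℂ) ⊗ₖ σ)}.Nonempty := by
  have hc : (0 : ℝ) < Fintype.card m := by exact_mod_cast Fintype.card_pos
  have hc' : (Fintype.card m : ℂ) ≠ 0 := by exact_mod_cast hc.ne'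
  set c : ℂ := (((Fintype.card m : ℝ)⁻¹ : ℝ) : ℂ) with hcdef
  have hc0 : c ≠ 0 := by
    rw [hcdef]
    exact_mod_cast (inv_pos.2 hc).ne'
  have hk : (1 : Matrix n n ℂ) ⊗ₖ (c • (1 : Matrix m m ℂ)) = c • 1 := by
    rw [kronecker_smul, one_kronecker_one]
  have hcond : (ρ * ((1 : Matrix n n ℂ) ⊗ₖ (c • (1 : Matrix m m ℂ)))).trace ≠ 0 ∧
      (dominates ((1 : Matrix n n ℂ) ⊗ₖ (c • (1 : Matrix m m ℂ))) ρ ∨ α < 1) := by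
    rw [hk]
    refine ⟨by simpa [htr] using hc0, Or.inl fun v hv => ?_⟩
    rw [smul_mulVec, one_mulVec, smul_eq_zero] at hv
    rw [hv.resolve_left hc0, mulVec_zero]
  obtain ⟨y, hy⟩ : ∃ y : ℝ, (y : EReal)
      = - Dtilde α ρ ((1 : Matrix n n ℂ) ⊗ₖ (c • (1 : Matrix m m ℂ))) := by
    rw [Dtilde, if_pos hcond, ← EReal.coe_neg]
    exact ⟨_, rfl⟩
  refine ⟨y, c • (1 : Matrix m m ℂ), ?_, ?_, ?_, hy⟩
  · refine PosSemidef.one.smul ?_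
    rw [hcdef]
    exact_mod_cast (inv_pos.2 hc).le
  · exact smul_ne_zero hc0 one_ne_zero
  · rw [trace_smul, trace_one, hcdef]
    simp [hc']

end

section

variable {dA dB dC : ℕ}

/-- The marginal on the system `C` of a matrix on `A × B × C`. -/
def marginalC (ρ : Matrix (Fin dA × Fin dB × Fin dC) (Fin dA × Fin dB × Fin dC) ℂ) :
    Matrix (Fin dC) (Fin dC) ℂ :=
  Matrix.of fun c c' : Fin dC => ∑ a : Fin dA, ∑ b : Fin dB, ρ (a, b, c) (a, b, c')

lemma trace_marginalC_mul (ρ : Matrix (Fin dA × Fin dB × Fin dC) (Fin dA × Fin dB × Fin dC) ℂ)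
    (N : Matrix (Fin dC) (Fin dC) ℂ) :
    (marginalC ρ * N).trace
      = (ρ * ((1 : Matrix (Fin dA) (Fin dA) ℂ) ⊗ₖ
        ((1 : Matrix (Fin dB) (Fin dB) ℂ) ⊗ₖ N))).trace := by
  simp only [trace, diag_apply, mul_apply, Fintype.sum_prod_type, kroneckerMap_apply, one_apply,
    marginalC, of_apply, ite_mul, mul_ite, one_mul, zero_mul, mul_zero,
    Finset.sum_ite_irrel, Finset.sum_const_zero, Finset.sum_ite_eq', Finset.mem_univ, if_true,
    Finset.sum_mul]
  calc _ = ∑ c, ∑ a, ∑ b, ∑ c', ρ (a, b, c) (a, b, c') * N c' c := by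
        refine Finset.sum_congr rfl fun c _ => ?_
        rw [Finset.sum_comm]
        refine Finset.sum_congr rfl fun a _ => ?_
        rw [Finset.sum_comm]
    _ = _ := by
        rw [Finset.sum_comm]
        refine Finset.sum_congr rfl fun a _ => ?_
        rw [Finset.sum_comm]

lemma marginalC_posSemidef {ρ : Matrix (Fin dA × Fin dB × Fin dC) (Fin dA × Fin dB × Fin dC) ℂ}
    (hρ : ρ.PosSemidef) : (marginalC ρ).PosSemidef := by
  have h : marginalC ρ = ∑ a : Fin dA, ∑ b : Fin dB,
      ρ.submatrix (fun c => (a, b, c)) (fun c => (a, b, c)) := by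
    ext c c'
    simp [marginalC, Matrix.sum_apply]
  rw [h]
  exact posSemidef_sum _ fun a _ => posSemidef_sum _ fun b _ => hρ.submatrix _

lemma mul_one_kronecker_support
    {ρ : Matrix (Fin dA × Fin dB × Fin dC) (Fin dA × Fin dB × Fin dC) ℂ} (hρ : ρ.PosSemidef) :
    ρ * ((1 : Matrix (Fin dA) (Fin dA) ℂ) ⊗ₖ
      ((1 : Matrix (Fin dB) (Fin dB) ℂ) ⊗ₖ matPow (marginalC ρ) 0)) = ρ := by
  have hC := marginalC_posSemidef hρ
  have h0 : ρ * ((1 : Matrix (Fin dA) (Fin dA) ℂ) ⊗ₖ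
      ((1 : Matrix (Fin dB) (Fin dB) ℂ) ⊗ₖ (1 - matPow (marginalC ρ) 0))) = 0 := by
    refine mul_eq_zero_of_trace hρ
      (PosSemidef.one.kronecker (PosSemidef.one.kronecker (one_sub_matPow_zero_posSemidef hC))) ?_
    rw [← trace_marginalC_mul, mul_sub, mul_one, mul_matPow_zero hC, sub_self, trace_zero]
  have h1 := congrArg (ρ * ·) (show (1 : Matrix (Fin dA) (Fin dA) ℂ) ⊗ₖ
      ((1 : Matrix (Fin dB) (Fin dB) ℂ) ⊗ₖ (1 - matPow (marginalC ρ) 0))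
      + (1 : Matrix (Fin dA) (Fin dA) ℂ) ⊗ₖ
      ((1 : Matrix (Fin dB) (Fin dB) ℂ) ⊗ₖ matPow (marginalC ρ) 0) = 1 by
    rw [← kronecker_add, ← kronecker_add, sub_add_cancel, one_kronecker_one, one_kronecker_one])
  simpa [mul_add, h0] using h1

lemma reindex_eACB_kronecker (σ : Matrix (Fin dB) (Fin dB) ℂ) :
    reindex (eACB dA dB dC) (eACB dA dB dC)
      ((1 : Matrix (Fin dA) (Fin dA) ℂ) ⊗ₖ (σ ⊗ₖ (1 : Matrix (Fin dC) (Fin dC) ℂ)))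
      = (1 : Matrix (Fin dA × Fin dC) (Fin dA × Fin dC) ℂ) ⊗ₖ σ := by
  rw [← one_kronecker_one]
  ext i j
  simp only [reindex_apply, submatrix_apply, kroneckerMap_apply, eACB, Equiv.coe_fn_symm_mk]
  ring

lemma exists_neg_Dtilde_ge {α : ℝ} (hα : α ∈ Set.Ioo (0 : ℝ) 1 ∪ Set.Ioi 1)
    {ρ : Matrix (Fin dA × Fin dB × Fin dC) (Fin dA × Fin dB × Fin dC) ℂ}
    (hρ : ρ.PosSemidef) (htr : ρ.trace = 1) {σ : Matrix (Fin dB) (Fin dB) ℂ}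
    (hσ : σ.PosSemidef) (hσ1 : σ.trace.re ≤ 1) {x : ℝ}
    (hx : (x : EReal) = - Dtilde α (reindex (eACB dA dB dC) (eACB dA dB dC) ρ)
      ((1 : Matrix (Fin dA × Fin dC) (Fin dA × Fin dC) ℂ) ⊗ₖ σ)) :
    ∃ y : ℝ, x - Real.logb 2 (marginalC ρ).rank ≤ y ∧
      ∃ τ : Matrix (Fin dB × Fin dC) (Fin dB × Fin dC) ℂ, τ.PosSemidef ∧ τ ≠ 0 ∧
        τ.trace.re ≤ 1 ∧ (y : EReal) = - Dtilde α ρ ((1 : Matrix (Fin dA) (Fin dA) ℂ) ⊗ₖ τ) := by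
  have hα0 : 0 < α := by
    rcases hα with h | h
    · exact h.1
    · exact zero_lt_one.trans h
  have hα1 : α - 1 ≠ 0 := by
    rcases hα with h | h
    · exact (sub_neg.2 h.2).ne
    · exact (sub_pos.2 h).ne'
  have hC := marginalC_posSemidef hρ
  set e := eACB dA dB dC
  set P := matPow (marginalC ρ) 0 with hP
  set r : ℝ := ((marginalC ρ).rank : ℝ) with hr
  have hPpsd : P.PosSemidef := hC.matPow 0
  have hPtr : P.trace = (r : ℂ) := by rw [hP, trace_matPow_zero hC, hr]; simp
  have hr1 : 1 ≤ r := by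
    have h : (marginalC ρ).rank ≠ 0 := by
      intro h
      have h0 : P = 0 := by
        rw [← hPpsd.trace_eq_zero_iff, hPtr, hr, h]; simp
      have h1 := mul_one_kronecker_support hρ
      rw [← hP, h0, kronecker_zero, kronecker_zero, mul_zero] at h1
      rw [← h1, trace_zero] at htr
      exact zero_ne_one htr
    rw [hr]
    exact_mod_cast Nat.one_le_iff_ne_zero.2 h
  have hr0 : 0 < r := by linarith
  have hrC : (r : ℂ) ≠ 0 := by exact_mod_cast hr0.ne'
  set Pc := (1 : Matrix (Fin dA) (Fin dA) ℂ) ⊗ₖ ((1 : Matrix (Fin dB) (Fin dB) ℂ) ⊗ₖ P) with hPc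
  have hρP : ρ * Pc = ρ := mul_one_kronecker_support hρ
  have hPρ : Pc * ρ = ρ := by
    have hPcH : Pcᴴ = Pc :=
      (PosSemidef.one.kronecker (PosSemidef.one.kronecker hPpsd)).isHermitian.eq
    have h := congrArg conjTranspose hρP
    rwa [conjTranspose_mul, hρ.isHermitian.eq, hPcH] at h
  let K : Matrix (Fin dB) (Fin dB) ℂ →
      Matrix (Fin dA × Fin dB × Fin dC) (Fin dA × Fin dB × Fin dC) ℂ :=
    fun s => (1 : Matrix (Fin dA) (Fin dA) ℂ) ⊗ₖ (s ⊗ₖ (1 : Matrix (Fin dC) (Fin dC) ℂ))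
  have hKe : ∀ s, reindex e e (K s)
      = (1 : Matrix (Fin dA × Fin dC) (Fin dA × Fin dC) ℂ) ⊗ₖ s := reindex_eACB_kronecker
  have hKP : ∀ s, K s * Pc = (1 : Matrix (Fin dA) (Fin dA) ℂ) ⊗ₖ (s ⊗ₖ P) := by
    intro s
    simp only [K, hPc, ← mul_kronecker_mul, one_mul, mul_one]
  have hPK : ∀ s, Pc * K s = (1 : Matrix (Fin dA) (Fin dA) ℂ) ⊗ₖ (s ⊗ₖ P) := by
    intro s
    simp only [K, hPc, ← mul_kronecker_mul, one_mul, mul_one]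
  have hmul : ∀ X Y : Matrix (Fin dA × Fin dB × Fin dC) (Fin dA × Fin dB × Fin dC) ℂ,
      reindex e e X * reindex e e Y = reindex e e (X * Y) := by
    intro X Y
    simp only [reindex_apply, submatrix_mul_equiv]
  set τ := ((r⁻¹ : ℝ) : ℂ) • (σ ⊗ₖ P) with hτ
  have h1τ : (1 : Matrix (Fin dA) (Fin dA) ℂ) ⊗ₖ τ = ((r⁻¹ : ℝ) : ℂ) • (K σ * Pc) := by
    rw [hτ, kronecker_smul, hKP]
  have hrinv : ((r⁻¹ : ℝ) : ℂ) ≠ 0 := by exact_mod_cast (inv_pos.2 hr0).ne'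
  set t := (1 - α) / (2 * α) with ht
  have hpow1 : matPow ((1 : Matrix (Fin dA × Fin dC) (Fin dA × Fin dC) ℂ) ⊗ₖ σ) t
      = reindex e e (K (matPow σ t)) := by
    rw [matPow_kronecker PosSemidef.one hσ, matPow_one_left, hKe]
  have hpow2 : matPow ((1 : Matrix (Fin dA) (Fin dA) ℂ) ⊗ₖ τ) t
      = (((r⁻¹) ^ t : ℝ) : ℂ) • (K (matPow σ t) * Pc) := by
    rw [hτ, matPow_kronecker PosSemidef.one ((hσ.kronecker hPpsd).smul
        (by exact_mod_cast (inv_pos.2 hr0).le)),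
      matPow_smul (hσ.kronecker hPpsd) (inv_pos.2 hr0),
      matPow_kronecker hσ hPpsd, matPow_one_left, hP, matPow_matPow_zero hC, ← hP,
      kronecker_smul, hKP]
  set X := K (matPow σ t) * ρ * K (matPow σ t) with hXdef
  have hKpsd : (K (matPow σ t)).PosSemidef :=
    PosSemidef.one.kronecker ((hσ.matPow t).kronecker PosSemidef.one)
  have hXpsd : X.PosSemidef := by
    have h := hρ.conjTranspose_mul_mul_same (K (matPow σ t))
    rwa [hKpsd.isHermitian.eq] at h
  have hX1 : reindex e e (K (matPow σ t)) * reindex e e ρ * reindex e e (K (matPow σ t))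
      = reindex e e X := by rw [hmul, hmul]
  have hX2 : (((r⁻¹) ^ t : ℝ) : ℂ) • (K (matPow σ t) * Pc) * ρ
        * (((r⁻¹) ^ t : ℝ) : ℂ) • (K (matPow σ t) * Pc)
      = (((r⁻¹) ^ t * (r⁻¹) ^ t : ℝ) : ℂ) • X := by
    have h : K (matPow σ t) * Pc * ρ * (K (matPow σ t) * Pc) = X := by
      rw [show K (matPow σ t) * Pc = Pc * K (matPow σ t) by rw [hKP, hPK]]
      rw [show Pc * K (matPow σ t) * ρ * (Pc * K (matPow σ t))
        = Pc * K (matPow σ t) * (ρ * Pc) * K (matPow σ t) by simp only [mul_assoc], hρP]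
      rw [show Pc * K (matPow σ t) = K (matPow σ t) * Pc by rw [hKP, hPK], mul_assoc _ Pc, hPρ]
    rw [Matrix.smul_mul, Matrix.smul_mul, Matrix.mul_smul, smul_smul, h]
    push_cast
    rfl
  have hscale : ((r⁻¹) ^ t * (r⁻¹) ^ t) ^ α = r ^ (α - 1) := by
    rw [← Real.rpow_add (inv_pos.2 hr0), ← Real.rpow_mul (inv_pos.2 hr0).le,
      Real.inv_rpow hr0.le, ← Real.rpow_neg hr0.le]
    congr 1
    rw [ht]
    field_simp
    ring
  have htrρ : (reindex e e ρ).trace = 1 := by rw [trace_reindex_self, htr]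
  unfold Dtilde at hx
  split_ifs at hx with hcond
  swap
  · simp at hx
  rw [← ht, hpow1, hX1, matPow_reindex e hXpsd, trace_reindex_self, htrρ, Complex.one_re,
    div_one] at hx
  have hx' : x = -((α - 1)⁻¹ * Real.logb 2 (matPow X α).trace.re) := by exact_mod_cast hx
  rw [← hKe, hmul, trace_reindex_self] at hcond
  have hcond2 : (ρ * ((1 : Matrix (Fin dA) (Fin dA) ℂ) ⊗ₖ τ)).trace ≠ 0 ∧
      (dominates ((1 : Matrix (Fin dA) (Fin dA) ℂ) ⊗ₖ τ) ρ ∨ α < 1) := by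
    rw [h1τ]
    refine ⟨?_, hcond.2.imp_left fun hd v hv => ?_⟩
    · rw [Matrix.mul_smul, trace_smul, smul_eq_mul, trace_mul_comm, mul_assoc, hPρ, trace_mul_comm]
      exact mul_ne_zero hrinv hcond.1
    · rw [smul_mulVec, smul_eq_zero, ← mulVec_mulVec] at hv
      have hv' := hv.resolve_left hrinv
      have hd' := hd ((Pc *ᵥ v) ∘ e.symm) (by
        rw [reindex_apply, submatrix_mulVec_equiv]
        simp [Function.comp_assoc, hv'])
      rw [reindex_apply, submatrix_mulVec_equiv] at hd'
      simp only [Function.comp_assoc, Equiv.symm_symm, Equiv.symm_comp_self,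
        Function.comp_id, mulVec_mulVec, hρP] at hd'
      funext i
      simpa using congrFun hd' (e i)
  refine ⟨-((α - 1)⁻¹ * Real.logb 2 (r ^ (α - 1) * (matPow X α).trace.re)), ?_, τ, ?_, ?_, ?_, ?_⟩
  · rw [hx']
    rcases eq_or_ne (matPow X α).trace.re 0 with h | h
    · rw [h, mul_zero, Real.logb_zero]
      have := Real.logb_nonneg one_lt_two hr1
      linarith
    · rw [Real.logb_mul (Real.rpow_pos_of_pos hr0 _).ne' h, Real.logb_rpow_eq_mul_logb_of_pos hr0,
        mul_add, inv_mul_cancel_left₀ hα1]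
      linarith
  · exact (hσ.kronecker hPpsd).smul (by exact_mod_cast (inv_pos.2 hr0).le)
  · intro h
    rw [h, kronecker_zero, mul_zero, trace_zero] at hcond2
    exact hcond2.1 rfl
  · rw [hτ, trace_smul, trace_kronecker, hPtr, smul_eq_mul]
    have : ((r⁻¹ : ℝ) : ℂ) * (σ.trace * (r : ℂ)) = σ.trace := by
      push_cast
      field_simp
    rwa [this]
  · rw [Dtilde, if_pos hcond2, ← ht, hpow2, hX2,
      matPow_smul hXpsd (by positivity), hscale, trace_smul, htr, Complex.one_re, div_one,
      smul_eq_mul, Complex.re_ofReal_mul, ← EReal.coe_neg]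

end

/-- chain rule `H̃_α(A|BC) ≥ H̃_α(AC|B) - log₂ rank(ρ_C)`. -/
theorem stmt14 {dA dB dC : ℕ} {α : ℝ} (hα : α ∈ Set.Ioo (0 : ℝ) 1 ∪ Set.Ioi 1)
    (ρ : Matrix (Fin dA × Fin dB × Fin dC) (Fin dA × Fin dB × Fin dC) ℂ)
    (hρ : ρ.PosSemidef) (htr : ρ.trace = 1) :
    condH α (Matrix.reindex (eACB dA dB dC) (eACB dA dB dC) ρ)
        - Real.logb 2
          ((Matrix.of fun c c' : Fin dC =>
            ∑ a : Fin dA, ∑ b : Fin dB, ρ (a, b, c) (a, b, c')).rank)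
      ≤ condH α ρ := by

  change _ - Real.logb 2 (marginalC ρ).rank ≤ _
  have hne : Nonempty (Fin dA × Fin dB × Fin dC) := by
    by_contra h
    rw [not_nonempty_iff] at h
    simp [trace] at htr
  obtain ⟨a, b, c⟩ := hne
  have : Nonempty (Fin dA) := ⟨a⟩
  have : Nonempty (Fin dB) := ⟨b⟩
  have : Nonempty (Fin dC) := ⟨c⟩
  rw [sub_le_iff_le_add]
  unfold condH
  refine csSup_le (nonempty_neg_Dtilde α (by rw [trace_reindex_self, htr])) ?_
  rintro x ⟨σ, hσ, -, hσ1, hx⟩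
  obtain ⟨y, hxy, hy⟩ := exists_neg_Dtilde_ge hα hρ htr hσ hσ1 hx
  have := le_csSup (bddAbove_neg_Dtilde hα hρ htr) hy
  linarith
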